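/- Write x_{ij} = x_i − x_j. The function f(x₁,x₂,x₃,x₄) = x₂₃x₂₄x₃₄/(2x₂₃x₁₄ − 3x₂₄x₁₃ + 6x₃₄x₁₂), defined on the open set U = {x ∈ ℝ⁴ : 2x₂₃x₁₄ − 3x₂₄x₁₃ + 6x₃₄x₁₂ ≠ 0}, satisfies on U the heavenly equation (case A₀): (x₁−x₂)(x₃−x₄)f₁₂f₃₄ − (x₁−x₃)(x₂−x₄)f₁₃f₂₄ + (x₁−x₄)(x₂−x₃)f₁₄f₂₃ = 0. -/

import Mathlib

/-- Partial derivative `∂f/∂x_j` on ℝ⁴ (coordinates `x₁,…,x₄` are indexed by `Fin 4`,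
so `x_i` corresponds to index `i-1`). -/
noncomputable def pd (f : (Fin 4 → ℝ) → ℝ) (j : Fin 4) (x : Fin 4 → ℝ) : ℝ :=
  fderiv ℝ f x (Pi.single j 1)

/-- Second partial derivative `∂²f/∂x_i∂x_j` on ℝ⁴. -/
noncomputable def pd2 (f : (Fin 4 → ℝ) → ℝ) (i j : Fin 4) (x : Fin 4 → ℝ) : ℝ :=
  pd (pd f j) i x

theorem pd_const (c : ℝ) (j : Fin 4) (x : Fin 4 → ℝ) : pd (fun _ => c) j x = 0 := by
  simp [pd]

theorem pd_coord (i j : Fin 4) (x : Fin 4 → ℝ) :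
    pd (fun y => y i) j x = if i = j then 1 else 0 := by
  simp [pd, (hasFDerivAt_apply (𝕜 := ℝ) i x).fderiv, Pi.single_apply]

section

variable {f g : (Fin 4 → ℝ) → ℝ} {x : Fin 4 → ℝ}

theorem pd_add (hf : DifferentiableAt ℝ f x) (hg : DifferentiableAt ℝ g x) (j : Fin 4) :
    pd (fun y => f y + g y) j x = pd f j x + pd g j x := by
  simp [pd, fderiv_fun_add hf hg]

theorem pd_sub (hf : DifferentiableAt ℝ f x) (hg : DifferentiableAt ℝ g x) (j : Fin 4) :
    pd (fun y => f y - g y) j x = pd f j x - pd g j x := by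
  simp [pd, fderiv_fun_sub hf hg]

theorem pd_mul (hf : DifferentiableAt ℝ f x) (hg : DifferentiableAt ℝ g x) (j : Fin 4) :
    pd (fun y => f y * g y) j x = f x * pd g j x + g x * pd f j x := by
  simp [pd, fderiv_fun_mul hf hg]

theorem pd_congr (h : f =ᶠ[nhds x] g) (j : Fin 4) : pd f j x = pd g j x := by
  simp [pd, h.fderiv_eq]

theorem pd_div (hf : DifferentiableAt ℝ f x) (hg : DifferentiableAt ℝ g x) (hx : g x ≠ 0)
    (j : Fin 4) :
    pd (fun y => f y / g y) j x = (pd f j x * g x - f x * pd g j x) / (g x * g x) := by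
  have h : f =ᶠ[nhds x] fun y => f y / g y * g y := by
    filter_upwards [hg.continuousAt.eventually_ne hx] with y hy
    field_simp
  rw [pd_congr h j, pd_mul (by fun_prop (disch := assumption)) hg]
  field_simp
  ring

theorem differentiable_pd (hf : ContDiff ℝ 2 f) (j : Fin 4) : Differentiable ℝ (pd f j) :=
  ((hf.fderiv_right (m := 1) (by norm_num)).clm_apply contDiff_const).differentiable (by norm_num)

/-- The quotient rule for second partial derivatives. -/
theorem pd2_div (hf : ContDiff ℝ 2 f) (hg : ContDiff ℝ 2 g) (hx : g x ≠ 0) (i j : Fin 4) :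
    pd2 (fun y => f y / g y) i j x =
      (pd2 f i j x * g x ^ 2 - (pd f i x * pd g j x + pd f j x * pd g i x + f x * pd2 g i j x) * g x
        + 2 * f x * pd g i x * pd g j x) / g x ^ 3 := by
  have df : Differentiable ℝ f := hf.differentiable (by norm_num)
  have dg : Differentiable ℝ g := hg.differentiable (by norm_num)
  have dfj := differentiable_pd hf j
  have dgj := differentiable_pd hg j
  have key : pd (fun y => f y / g y) j =ᶠ[nhds x]
      fun y => (pd f j y * g y - f y * pd g j y) / (g y * g y) := by
    filter_upwards [dg.continuous.continuousAt.eventually_ne hx] with y hy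
    exact pd_div (df y) (dg y) hy j
  rw [pd2, pd_congr key, pd_div (by fun_prop) (by fun_prop) (mul_ne_zero hx hx),
    pd_sub (by fun_prop) (by fun_prop), pd_mul (dfj x) (dg x), pd_mul (df x) (dgj x),
    pd_mul (dg x) (dg x)]
  simp only [pd2]
  field_simp
  ring

end

set_option maxHeartbeats 1000000 in
/-- The function `f = x₂₃x₂₄x₃₄/(2x₂₃x₁₄ − 3x₂₄x₁₃ + 6x₃₄x₁₂)`
(`x_{ij} = x_i − x_j`), defined where the denominator is nonzero, satisfies the
heavenly equation (case A₀):
`(x₁−x₂)(x₃−x₄)f₁₂f₃₄ − (x₁−x₃)(x₂−x₄)f₁₃f₂₄ + (x₁−x₄)(x₂−x₃)f₁₄f₂₃ = 0`. -/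
theorem example_solution_heavenly_A0 :
    ∀ x : Fin 4 → ℝ,
      2 * (x 1 - x 2) * (x 0 - x 3) - 3 * (x 1 - x 3) * (x 0 - x 2)
        + 6 * (x 2 - x 3) * (x 0 - x 1) ≠ 0 →
      (let f : (Fin 4 → ℝ) → ℝ := fun y =>
        (y 1 - y 2) * (y 1 - y 3) * (y 2 - y 3) /
          (2 * (y 1 - y 2) * (y 0 - y 3) - 3 * (y 1 - y 3) * (y 0 - y 2)
            + 6 * (y 2 - y 3) * (y 0 - y 1))
       (x 0 - x 1) * (x 2 - x 3) * pd2 f 0 1 x * pd2 f 2 3 x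
       - (x 0 - x 2) * (x 1 - x 3) * pd2 f 0 2 x * pd2 f 1 3 x
       + (x 0 - x 3) * (x 1 - x 2) * pd2 f 0 3 x * pd2 f 1 2 x = 0) := by
  intro x hx
  set N : (Fin 4 → ℝ) → ℝ := fun y => (y 1 - y 2) * (y 1 - y 3) * (y 2 - y 3) with hN
  set D : (Fin 4 → ℝ) → ℝ := fun y =>
    2 * (y 1 - y 2) * (y 0 - y 3) - 3 * (y 1 - y 3) * (y 0 - y 2)
      + 6 * (y 2 - y 3) * (y 0 - y 1) with hD
  have cN : ContDiff ℝ 2 N := by fun_prop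
  have cD : ContDiff ℝ 2 D := by fun_prop
  have hDx : D x ≠ 0 := hx
  let δ : Fin 4 → Fin 4 → ℝ := fun i j => if i = j then 1 else 0
  have pN (j : Fin 4) : pd N j = fun y =>
      (y 1 - y 2) * (y 1 - y 3) * (δ 2 j - δ 3 j) + (y 2 - y 3) *
        ((y 1 - y 2) * (δ 1 j - δ 3 j) + (y 1 - y 3) * (δ 1 j - δ 2 j)) := by
    funext y
    simp (disch := fun_prop) only [hN, pd_mul, pd_sub, pd_coord, δ]
  have pD (j : Fin 4) : pd D j = fun y =>
      2 * ((y 1 - y 2) * (δ 0 j - δ 3 j) + (y 0 - y 3) * (δ 1 j - δ 2 j))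
      - 3 * ((y 1 - y 3) * (δ 0 j - δ 2 j) + (y 0 - y 2) * (δ 1 j - δ 3 j))
      + 6 * ((y 2 - y 3) * (δ 0 j - δ 1 j) + (y 0 - y 1) * (δ 2 j - δ 3 j)) := by
    funext y
    simp (disch := fun_prop) only [hD, pd_mul, pd_sub, pd_add, pd_const, pd_coord, δ]
    ring
  intro f
  have hf (i j : Fin 4) := pd2_div cN cD hDx i j
  change ∀ i j, pd2 f i j x = _ at hf
  simp only [hf]
  simp (disch := fun_prop) only [pd2, pN, pD, pd_mul, pd_sub, pd_add, pd_const, pd_coord]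
  field_simp
  simp [hN, hD, δ]
  ring
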